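/- Let P(a,b,z) = z³ − (4 + 2cos(a−b))z − 2cos a − 2cos b as a smooth real function on ℝ³. Then the set of points (a,b,z) with a,b ∈ [0,2π) satisfying simultaneously P = 0, ∂P/∂a = 0, ∂P/∂b = 0 and ∂P/∂z = 0 is exactly the four points {(π/3, 5π/3, −1), (5π/3, π/3, −1), (2π/3, 4π/3, 1), (4π/3, 2π/3, 1)}. -/

import Mathlib

open Real

/-- The characteristic polynomial of the triangle-graph Harper Hamiltonian with one
double bond, as a smooth real function of `(a, b, z)`. -/
noncomputable def P (a b z : ℝ) : ℝ :=
  z ^ 3 - (4 + 2 * Real.cos (a - b)) * z - 2 * Real.cos a - 2 * Real.cos b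

/-- Partial derivative in the first variable. -/
noncomputable def pda (f : ℝ → ℝ → ℝ → ℝ) (a b z : ℝ) : ℝ :=
  deriv (fun t => f t b z) a

/-- Partial derivative in the second variable. -/
noncomputable def pdb (f : ℝ → ℝ → ℝ → ℝ) (a b z : ℝ) : ℝ :=
  deriv (fun t => f a t z) b

/-- Partial derivative in the third variable. -/
noncomputable def pdz (f : ℝ → ℝ → ℝ → ℝ) (a b z : ℝ) : ℝ :=
  deriv (fun t => f a b t) z

theorem pda_P (a b z : ℝ) : pda P a b z = 2 * sin (a - b) * z + 2 * sin a := by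
  have h : HasDerivAt (fun t => P t b z)
      (0 - (0 + 2 * (-sin (a - b) * 1)) * z - 2 * -sin a - 0) a :=
    ((((hasDerivAt_const a (z ^ 3)).sub
      (((hasDerivAt_const a (4 : ℝ)).add
        ((((hasDerivAt_id a).sub_const b).cos).const_mul 2)).mul_const z)).sub
      ((hasDerivAt_cos a).const_mul 2)).sub (hasDerivAt_const a (2 * cos b)))
  rw [pda, h.deriv]
  ring

theorem P_comm (a b z : ℝ) : P a b z = P b a z := by
  rw [P, P, ← cos_neg (a - b), neg_sub]
  ring

theorem pdb_P (a b z : ℝ) : pdb P a b z = -2 * sin (a - b) * z + 2 * sin b := by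
  have h : pdb P a b z = pda P b a z := by
    simp only [pdb, pda, P_comm a]
  rw [h, pda_P, ← neg_sub a b, sin_neg]
  ring

theorem pdz_P (a b z : ℝ) : pdz P a b z = 3 * z ^ 2 - (4 + 2 * cos (a - b)) := by
  have h : HasDerivAt (fun t => P a b t)
      (3 * z ^ 2 - (4 + 2 * cos (a - b)) * 1) z := by
    simpa [P] using ((((hasDerivAt_pow 3 z).sub
      ((hasDerivAt_id z).const_mul (4 + 2 * cos (a - b)))).sub_const
        (2 * cos a)).sub_const (2 * cos b))
  rw [pdz, h.deriv]
  ring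

theorem eq_or_eq_two_pi_sub_of_cos_eq {a c : ℝ} (ha : a ∈ Set.Ico 0 (2 * π))
    (hc : c ∈ Set.Icc 0 π) (h : cos a = cos c) : a = c ∨ a = 2 * π - c := by
  rcases le_total a π with h' | h'
  · exact Or.inl (injOn_cos ⟨ha.1, h'⟩ hc h)
  · right
    have := injOn_cos (x₁ := 2 * π - a) ⟨by linarith [ha.2], by linarith⟩ hc
      (by rw [cos_two_pi_sub, h])
    linarith

/-- The critical equations, together with `P = 0`, written in `(x, y) = (cos a, sin a)` and
`(u, v) = (cos b, sin b)`. -/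
theorem critical_equations_solution {x y u v z : ℝ} (hxy : y ^ 2 + x ^ 2 = 1)
    (huv : v ^ 2 + u ^ 2 = 1)
    (hP : z ^ 3 - (4 + 2 * (x * u + y * v)) * z - 2 * x - 2 * u = 0)
    (ha : 2 * (y * u - x * v) * z + 2 * y = 0)
    (hb : -2 * (y * u - x * v) * z + 2 * v = 0)
    (hz : 3 * z ^ 2 - (4 + 2 * (x * u + y * v)) = 0) :
    (z = 1 ∨ z = -1) ∧ x = -z / 2 ∧ u = -z / 2 ∧ v = -y ∧ y ≠ 0 := by
  obtain rfl : v = -y := by linarith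
  have hsum : x + u = -z ^ 3 := by linear_combination (z * hz - hP) / 2
  have hux : (u - x) * (u + x) = 0 := by linear_combination huv - hxy
  rcases mul_eq_zero.mp hux with h | h
  · obtain rfl : u = x := by linarith
    have hy : y * (2 * u * z + 1) = 0 := by linear_combination ha / 2
    rcases mul_eq_zero.mp hy with rfl | h1
    · have hz2 : z ^ 2 = 2 := by linear_combination hz / 3 + 2 / 3 * hxy
      have h6 : 4 * u ^ 2 = z ^ 6 := by
        linear_combination (2 * u - z ^ 3) * hsum
      have : z ^ 6 = 8 := by
        rw [show z ^ 6 = (z ^ 2) ^ 3 by ring, hz2]; norm_num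
      exfalso
      linarith
    · have h4 : (z ^ 2 + 1) * ((z - 1) * (z + 1)) = 0 := by
        linear_combination z * hsum - h1
      have hz1 : z = 1 ∨ z = -1 := by
        rcases mul_eq_zero.mp h4 with h | h
        · nlinarith [sq_nonneg z]
        · rcases mul_eq_zero.mp h with h | h
          · left; linarith
          · right; linarith
      have hu : u = -z / 2 := by
        rcases hz1 with rfl | rfl <;> linarith
      refine ⟨hz1, hu, hu, rfl, ?_⟩
      rintro rfl
      rcases hz1 with rfl | rfl <;> norm_num [hu] at hxy
  · obtain rfl : u = -x := by linarith
    have hz0 : z = 0 := by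
      have : z ^ 3 = 0 := by linarith
      exact pow_eq_zero_iff (by norm_num) |>.mp this
    subst hz0
    exfalso
    linarith

theorem sin_sub_two_pi_sub (c : ℝ) : sin (c - (2 * π - c)) = 2 * sin c * cos c := by
  rw [← sin_two_mul, ← sin_sub_two_pi (2 * c)]
  ring_nf

theorem cos_sub_two_pi_sub (c : ℝ) : cos (c - (2 * π - c)) = 2 * cos c ^ 2 - 1 := by
  rw [← cos_two_mul, ← cos_sub_two_pi (2 * c)]
  ring_nf

theorem critical_of_cos_eq {c z : ℝ} (hz : z ^ 2 = 1) (hc : cos c = -z / 2) :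
    P c (2 * π - c) z = 0 ∧ pda P c (2 * π - c) z = 0 ∧
      pdb P c (2 * π - c) z = 0 ∧ pdz P c (2 * π - c) z = 0 := by
  rw [pda_P, pdb_P, pdz_P, P, sin_sub_two_pi_sub, cos_sub_two_pi_sub, cos_two_pi_sub,
    sin_two_pi_sub, hc]
  refine ⟨?_, ?_, ?_, ?_⟩
  · ring
  · linear_combination -2 * sin c * hz
  · linear_combination 2 * sin c * hz
  · linear_combination 2 * hz

theorem cos_two_pi_div_three : cos (2 * π / 3) = -1 / 2 := by
  rw [show 2 * π / 3 = π - π / 3 by ring, cos_pi_sub, cos_pi_div_three]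
  norm_num

theorem doubled_triangle_critical_points :
    {p : ℝ × ℝ × ℝ |
        p.1 ∈ Set.Ico 0 (2 * π) ∧ p.2.1 ∈ Set.Ico 0 (2 * π) ∧
        P p.1 p.2.1 p.2.2 = 0 ∧
        pda P p.1 p.2.1 p.2.2 = 0 ∧
        pdb P p.1 p.2.1 p.2.2 = 0 ∧
        pdz P p.1 p.2.1 p.2.2 = 0} =
      {(π / 3, 5 * π / 3, (-1 : ℝ)), (5 * π / 3, π / 3, (-1 : ℝ)),
       (2 * π / 3, 4 * π / 3, (1 : ℝ)), (4 * π / 3, 2 * π / 3, (1 : ℝ))} := by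
  have hpi := pi_pos
  have angles {a b c : ℝ} (ha : a ∈ Set.Ico 0 (2 * π)) (hb : b ∈ Set.Ico 0 (2 * π))
      (hc : c ∈ Set.Icc 0 π) (hac : cos a = cos c) (hbc : cos b = cos c)
      (hs : sin b = -sin a) (h0 : sin a ≠ 0) :
      (a = c ∧ b = 2 * π - c) ∨ (a = 2 * π - c ∧ b = c) := by
    have hab : a ≠ b := by
      rintro rfl
      exact h0 (by linarith)
    rcases eq_or_eq_two_pi_sub_of_cos_eq ha hc hac with h | h <;>
      rcases eq_or_eq_two_pi_sub_of_cos_eq hb hc hbc with h' | h'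
    · exact absurd (h.trans h'.symm) hab
    · exact Or.inl ⟨h, h'⟩
    · exact Or.inr ⟨h, h'⟩
    · exact absurd (h.trans h'.symm) hab
  have e₁ : 5 * π / 3 = 2 * π - π / 3 := by ring
  have e₂ : 4 * π / 3 = 2 * π - 2 * π / 3 := by ring
  ext ⟨a, b, z⟩
  simp only [Set.mem_ofPred_eq, Set.mem_insert_iff, Set.mem_singleton_iff, Prod.mk.injEq, e₁, e₂]
  constructor
  · rintro ⟨ha, hb, hP, hPa, hPb, hPz⟩
    rw [pda_P, sin_sub] at hPa
    rw [pdb_P, sin_sub] at hPb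
    rw [pdz_P, cos_sub] at hPz
    rw [P, cos_sub] at hP
    obtain ⟨rfl | rfl, hx, hu, hv, hy⟩ := critical_equations_solution
      (sin_sq_add_cos_sq a) (sin_sq_add_cos_sq b) hP hPa hPb hPz
    · have := angles ha hb (c := 2 * π / 3) ⟨by linarith, by linarith⟩
        (by rw [hx, cos_two_pi_div_three]) (by rw [hu, cos_two_pi_div_three]) hv hy
      tauto
    · have := angles ha hb (c := π / 3) ⟨by linarith, by linarith⟩
        (by rw [hx, cos_pi_div_three]; norm_num) (by rw [hu, cos_pi_div_three]; norm_num) hv hy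
      tauto
  · have mirror (c : ℝ) : 2 * π - (2 * π - c) = c := sub_sub_cancel _ _
    have h₁ : cos (π / 3) = -(-1 : ℝ) / 2 := by rw [cos_pi_div_three]; norm_num
    have h₂ := cos_two_pi_div_three
    rintro (⟨rfl, rfl, rfl⟩ | ⟨rfl, rfl, rfl⟩ | ⟨rfl, rfl, rfl⟩ | ⟨rfl, rfl, rfl⟩) <;>
      refine ⟨⟨by linarith, by linarith⟩, ⟨by linarith, by linarith⟩, ?_⟩
    · exact critical_of_cos_eq (by norm_num) h₁
    · simpa only [mirror] using critical_of_cos_eq (c := 2 * π - π / 3) (z := -1) (by norm_num)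
        (by rw [cos_two_pi_sub, h₁])
    · exact critical_of_cos_eq (by norm_num) h₂
    · simpa only [mirror] using critical_of_cos_eq (c := 2 * π - 2 * π / 3) (z := 1) (by norm_num)
        (by rw [cos_two_pi_sub, h₂])
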